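/- arXiv:2010.10460 — 2 statements merged into one kernel-verified Lean document; each statement's English description precedes it below -/
import Mathlib

section
/- Let g : ℝ³ → ℂ be integrable and radial, i.e. g(ξ) = g(ξ') whenever ‖ξ‖ = ‖ξ'‖. Then for every real t ≠ 0 one has ∫_{ℝ³} e^{i t ξ₃/‖ξ‖} g(ξ) dξ = (sin t / t) · ∫_{ℝ³} g(ξ) dξ. -/
open MeasureTheory

/-- Integrals of products of an angular and a radial function factor in polar coordinates. -/
theorem integral_angular_mul_radial {E : Type*} [NormedAddCommGroup E] [NormedSpace ℝ E]
    [FiniteDimensional ℝ E] [Nontrivial E] [MeasurableSpace E] [BorelSpace E] (μ : Measure E)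
    [μ.IsAddHaarMeasure] (f : E → ℂ) (G : ℝ → ℂ) :
    ∫ x, f (‖x‖⁻¹ • x) * G ‖x‖ ∂μ
      = (∫ x, f x.1 ∂μ.toSphere)
        * ∫ r : Set.Ioi (0 : ℝ), G r ∂(Measure.volumeIoiPow (Module.finrank ℝ E - 1)) := by
  calc
    ∫ x, f (‖x‖⁻¹ • x) * G ‖x‖ ∂μ
        = ∫ x : ({(0)}ᶜ : Set E), f (‖x.1‖⁻¹ • x.1) * G ‖x.1‖ ∂(μ.comap (↑)) := by
      rw [integral_subtype_comap (measurableSet_singleton _).compl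
        fun x ↦ f (‖x‖⁻¹ • x) * G ‖x‖, restrict_compl_singleton]
    _ = ∫ x, f x.1 * G x.2 ∂μ.toSphere.prod (.volumeIoiPow (Module.finrank ℝ E - 1)) := by
      simpa using μ.measurePreserving_homeomorphUnitSphereProd.integral_comp
        (Homeomorph.measurableEmbedding _) (fun p ↦ f p.1.1 * G p.2.1)
    _ = _ := integral_prod_mul (fun x : Metric.sphere (0 : E) 1 ↦ f x.1)
        (fun r : Set.Ioi (0 : ℝ) ↦ G r)

theorem integral_sin_mul_comp_cos {φ : ℝ → ℂ} (hφ : Continuous φ) :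
    ∫ θ in (0 : ℝ)..Real.pi, (Real.sin θ : ℂ) * φ (Real.cos θ) = ∫ z in (-1 : ℝ)..1, φ z := by
  have h := intervalIntegral.integral_deriv_smul_comp (a := 0) (b := Real.pi) (f := Real.cos)
    (f' := fun θ ↦ -Real.sin θ) (g := φ) (fun x _ ↦ Real.hasDerivAt_cos x)
    (by fun_prop) hφ
  rw [Real.cos_zero, Real.cos_pi, intervalIntegral.integral_symm (-1) 1] at h
  rw [← neg_inj, ← h, ← intervalIntegral.integral_neg]
  simp

theorem norm_sq_eq_sq_add_norm_sq_removeNth (ξ : EuclideanSpace ℝ (Fin 3)) :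
    ‖ξ‖ ^ 2 = ξ 2 ^ 2 +
      ‖(WithLp.toLp 2 (fun j : Fin 2 ↦ ξ ((2 : Fin 3).succAbove j)) :
        EuclideanSpace ℝ (Fin 2))‖ ^ 2 := by
  rw [EuclideanSpace.real_norm_sq_eq, EuclideanSpace.real_norm_sq_eq,
    Fin.sum_univ_succAbove _ (2 : Fin 3)]

/-- Cylindrical splitting of the integral of a function of `ξ 2` and `‖ξ‖`. -/
theorem integral_fin_three_eq_integral_prod (H : ℝ → ℝ → ℂ) :
    ∫ ξ : EuclideanSpace ℝ (Fin 3), H (ξ 2) ‖ξ‖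
      = ∫ p : ℝ × EuclideanSpace ℝ (Fin 2), H p.1 √(p.1 ^ 2 + ‖p.2‖ ^ 2) := by
  have h₁ := (EuclideanSpace.volume_preserving_symm_measurableEquiv_toLp (Fin 3)).trans
    (volume_preserving_piFinSuccAbove (fun _ : Fin 3 ↦ ℝ) 2)
  have h₂ := (MeasurePreserving.id (volume : Measure ℝ)).prod
    (EuclideanSpace.volume_preserving_symm_measurableEquiv_toLp (Fin 2)).symm
  have h₁' := h₁.integral_comp' (g := fun p : ℝ × (Fin 2 → ℝ) ↦
    H p.1 √(p.1 ^ 2 + ‖(WithLp.toLp 2 p.2 : EuclideanSpace ℝ (Fin 2))‖ ^ 2))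
  have h₂' := h₂.integral_comp (((MeasurableEquiv.refl ℝ).prodCongr
      (MeasurableEquiv.toLp 2 (Fin 2 → ℝ))).measurableEmbedding)
    (fun p : ℝ × EuclideanSpace ℝ (Fin 2) ↦ H p.1 √(p.1 ^ 2 + ‖p.2‖ ^ 2))
  refine Eq.trans ?_ (h₁'.trans h₂')
  refine integral_congr_ae (.of_forall fun ξ ↦ ?_)
  have h := norm_sq_eq_sq_add_norm_sq_removeNth ξ
  change H (ξ 2) ‖ξ‖ = H (ξ 2) √(ξ 2 ^ 2 + ‖(WithLp.toLp 2 (fun j : Fin 2 ↦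
    ξ ((2 : Fin 3).succAbove j)) : EuclideanSpace ℝ (Fin 2))‖ ^ 2)
  rw [← h, Real.sqrt_sq (norm_nonneg _)]

theorem integral_fun_norm_fin_two (f : ℝ → ℂ) :
    ∫ x : EuclideanSpace ℝ (Fin 2), f ‖x‖
      = 2 * Real.pi * ∫ y in Set.Ioi (0 : ℝ), (y : ℂ) * f y := by
  rw [integral_fun_norm_addHaar]
  simp [Measure.real, Real.pi_nonneg, mul_assoc]

/-- Polar coordinates on the half plane `{ρ > 0}`. -/
theorem integral_halfPlane_eq_polar (F : ℝ × ℝ → ℂ) :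
    ∫ p in Set.univ ×ˢ Set.Ioi (0 : ℝ), F p
      = ∫ q in Set.Ioi (0 : ℝ) ×ˢ Set.Ioo 0 Real.pi,
          (q.1 : ℂ) * F (q.1 * Real.cos q.2, q.1 * Real.sin q.2) := by
  rw [← integral_indicator (MeasurableSet.univ.prod measurableSet_Ioi),
    ← integral_comp_polarCoord_symm, polarCoord_target,
    ← integral_indicator (measurableSet_Ioi.prod measurableSet_Ioo),
    ← integral_indicator (measurableSet_Ioi.prod measurableSet_Ioo)]
  congr 1
  ext ⟨r, θ⟩
  by_cases hr : 0 < r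
  swap
  · simp [Set.indicator, hr]
  by_cases hθ : θ ∈ Set.Ioo 0 Real.pi
  · have : 0 < Real.sin θ := Real.sin_pos_of_mem_Ioo hθ
    have h' : -Real.pi < θ := by linarith [hθ.1, Real.pi_pos]
    simp [Set.indicator, hr, hθ.1, hθ.2, h', this]
  · by_cases h' : θ ∈ Set.Ioo (-Real.pi) Real.pi
    · have h0 : θ ≤ 0 := by
        by_contra! h
        exact hθ ⟨h, h'.2⟩
      have : ¬ 0 < Real.sin θ :=
        (Real.sin_nonpos_of_nonpos_of_neg_pi_le h0 h'.1.le).not_gt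
      simp [Set.indicator, hr, h0.not_gt, this]
    · have : ¬ (-Real.pi < θ ∧ θ < Real.pi) := h'
      have h2 : ¬ (0 < θ ∧ θ < Real.pi) := hθ
      simp [Set.indicator, hr, this, h2]

theorem integral_angular_mul_gaussian {φ : ℝ → ℂ} (hφ : Continuous φ) (hb : ∀ x, ‖φ x‖ ≤ 1) :
    ∫ ξ : EuclideanSpace ℝ (Fin 3), φ (ξ 2 / ‖ξ‖) * (Real.exp (-1 * ‖ξ‖ ^ 2) : ℂ)
      = 2 * Real.pi * ((∫ r in Set.Ioi (0 : ℝ), (r : ℂ) ^ 2 * (Real.exp (-1 * r ^ 2) : ℂ))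
          * ∫ z in (-1 : ℝ)..1, φ z) := by
  have hexp (a b : ℝ) : (Real.exp (-1 * √(a ^ 2 + b ^ 2) ^ 2) : ℂ)
      = (Real.exp (-1 * a ^ 2) : ℂ) * (Real.exp (-1 * b ^ 2) : ℂ) := by
    rw [Real.sq_sqrt (by positivity), mul_add, Real.exp_add, Complex.ofReal_mul]
  have hint1 : Integrable (fun x : ℝ ↦ (Real.exp (-1 * x ^ 2) : ℂ)) :=
    (integrable_exp_neg_mul_sq one_pos).ofReal
  have hint2 : Integrable
      (fun x : EuclideanSpace ℝ (Fin 2) ↦ (Real.exp (-1 * ‖x‖ ^ 2) : ℂ)) := by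
    have : Integrable (fun x : EuclideanSpace ℝ (Fin 2) ↦ Real.exp (-1 * ‖x‖ ^ 2)) := by
      refine .of_integral_ne_zero ?_
      rw [GaussianFourier.integral_rexp_neg_mul_sq_norm one_pos]
      positivity
    exact this.ofReal
  rw [integral_fin_three_eq_integral_prod
    (fun z n ↦ φ (z / n) * (Real.exp (-1 * n ^ 2) : ℂ)), Measure.volume_eq_prod, integral_prod]
  swap
  · simp_rw [hexp]
    exact (hint1.mul_prod hint2).bdd_mul (c := 1)
      (Measurable.aestronglyMeasurable (by fun_prop)) (.of_forall fun _ ↦ hb _)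
  simp_rw [fun z : ℝ ↦ integral_fun_norm_fin_two
    (fun y ↦ φ (z / √(z ^ 2 + y ^ 2)) * (Real.exp (-1 * √(z ^ 2 + y ^ 2) ^ 2) : ℂ))]
  rw [integral_const_mul, ← setIntegral_univ, ← setIntegral_prod
    (fun p : ℝ × ℝ ↦ (p.2 : ℂ) * (φ (p.1 / √(p.1 ^ 2 + p.2 ^ 2))
      * (Real.exp (-1 * √(p.1 ^ 2 + p.2 ^ 2) ^ 2) : ℂ)))]
  swap
  · simp_rw [hexp]
    have := (hint1.mul_prod (integrable_mul_exp_neg_mul_sq one_pos).ofReal).bdd_mul (c := 1)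
      (f := fun p : ℝ × ℝ ↦ φ (p.1 / √(p.1 ^ 2 + p.2 ^ 2)))
      (Measurable.aestronglyMeasurable (by fun_prop)) (.of_forall fun _ ↦ hb _)
    refine (this.congr (.of_forall fun p ↦ ?_)).integrableOn
    simp only [RCLike.ofReal_mul, Complex.coe_algebraMap]
    ring
  rw [← Measure.volume_eq_prod, integral_halfPlane_eq_polar]
  congr 1
  rw [← integral_sin_mul_comp_cos hφ, intervalIntegral.integral_of_le Real.pi_nonneg,
    integral_Ioc_eq_integral_Ioo, ← setIntegral_prod_mul, ← Measure.volume_eq_prod]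
  refine setIntegral_congr_fun (measurableSet_Ioi.prod measurableSet_Ioo) fun q hq ↦ ?_
  have hr : 0 < q.1 := hq.1
  have hs : √((q.1 * Real.cos q.2) ^ 2 + (q.1 * Real.sin q.2) ^ 2) = q.1 := by
    rw [mul_pow, mul_pow, ← mul_add, Real.cos_sq_add_sin_sq, mul_one, Real.sqrt_sq hr.le]
  simp only [hs]
  rw [mul_div_cancel_left₀ _ hr.ne']
  push_cast
  ring

theorem integral_exp_I_mul {t : ℝ} (ht : t ≠ 0) :
    ∫ z in (-1 : ℝ)..1, Complex.exp (Complex.I * ((t * z : ℝ) : ℂ))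
      = 2 * ((Real.sin t / t : ℝ) : ℂ) := by
  have ht' : (t : ℂ) ≠ 0 := by exact_mod_cast ht
  have h := integral_exp_mul_complex (a := -1) (b := 1) (c := Complex.I * t)
    (mul_ne_zero Complex.I_ne_zero ht')
  simp only [Complex.ofReal_mul, ← mul_assoc]
  rw [h]
  push_cast
  rw [Complex.sin]
  field_simp
  simp only [Complex.I_sq]
  ring_nf

/-- The mean over the unit sphere of a function of the third coordinate. -/
theorem two_mul_integral_toSphere_fin_three {φ : ℝ → ℂ} (hφ : Continuous φ)
    (hb : ∀ x, ‖φ x‖ ≤ 1) :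
    2 * ∫ x, φ (x.1 2) ∂(volume : Measure (EuclideanSpace ℝ (Fin 3))).toSphere
      = (∫ z in (-1 : ℝ)..1, φ z)
        * ∫ _, (1 : ℂ) ∂(volume : Measure (EuclideanSpace ℝ (Fin 3))).toSphere := by
  have key (ψ : ℝ → ℂ) := integral_angular_mul_radial
    (volume : Measure (EuclideanSpace ℝ (Fin 3))) (fun x ↦ ψ (x 2))
    (fun r ↦ (Real.exp (-1 * r ^ 2) : ℂ))
  simp only [PiLp.smul_apply, smul_eq_mul, inv_mul_eq_div] at key
  have h₁ := key φ
  have h₂ := key fun _ ↦ 1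
  have hne : ∫ ξ : EuclideanSpace ℝ (Fin 3), (1 : ℂ) * (Real.exp (-1 * ‖ξ‖ ^ 2) : ℂ) ≠ 0 := by
    simp only [one_mul]
    rw [integral_complex_ofReal, GaussianFourier.integral_rexp_neg_mul_sq_norm one_pos,
      Complex.ofReal_ne_zero]
    positivity
  have hR := right_ne_zero_of_mul (h₂ ▸ hne)
  rw [integral_angular_mul_gaussian hφ hb] at h₁
  rw [integral_angular_mul_gaussian (φ := fun _ ↦ 1) continuous_const (by simp)] at h₂
  have h2 : ∫ _ in (-1 : ℝ)..1, (1 : ℂ) = 2 := by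
    rw [intervalIntegral.integral_const]
    norm_num
  rw [h2] at h₂
  apply mul_right_cancel₀ hR
  linear_combination (-2) * h₁ + (∫ z in (-1 : ℝ)..1, φ z) * h₂

/-- **Sharpness of the dispersive decay rate for radial data.**
If `g : ℝ³ → ℂ` is integrable and radial, then for every `t ≠ 0`,
`∫ e^{i t ξ₃/‖ξ‖} g(ξ) dξ = (sin t / t) ∫ g(ξ) dξ`. -/
theorem stmt_0 (g : EuclideanSpace ℝ (Fin 3) → ℂ)
    (hg : Integrable g)
    (hrad : ∀ ξ ξ' : EuclideanSpace ℝ (Fin 3), ‖ξ‖ = ‖ξ'‖ → g ξ = g ξ')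
    (t : ℝ) (ht : t ≠ 0) :
    ∫ ξ : EuclideanSpace ℝ (Fin 3),
        Complex.exp (Complex.I * ((t * (ξ 2 / ‖ξ‖) : ℝ) : ℂ)) * g ξ
      = ((Real.sin t / t : ℝ) : ℂ) * ∫ ξ : EuclideanSpace ℝ (Fin 3), g ξ := by
  set G : ℝ → ℂ := fun r ↦ g (EuclideanSpace.single 0 r)
  have hG (ξ) : g ξ = G ‖ξ‖ := hrad _ _ (by simp)
  have key (ψ : ℝ → ℂ) := integral_angular_mul_radial
    (volume : Measure (EuclideanSpace ℝ (Fin 3))) (fun x ↦ ψ (x 2)) G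
  simp only [PiLp.smul_apply, smul_eq_mul, inv_mul_eq_div] at key
  have h₁ := key fun z ↦ Complex.exp (Complex.I * ((t * z : ℝ) : ℂ))
  have h₂ := key fun _ ↦ 1
  have h₃ := two_mul_integral_toSphere_fin_three
    (φ := fun z ↦ Complex.exp (Complex.I * ((t * z : ℝ) : ℂ))) (by fun_prop)
    (fun x ↦ (Complex.norm_exp_I_mul_ofReal _).le)
  rw [integral_exp_I_mul ht] at h₃
  simp only [one_mul] at h₂
  simp only [hG]
  rw [h₁, h₂, ← mul_assoc]
  congr 1
  linear_combination h₃ / 2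
end

section
/- For every integer n ≥ 1 there exists a constant C > 0 such that the following holds. Let f : ℝ³ → ℝ be a Schwartz function and define iteratively f₀ := f and f_{b+1}(x) := x·∇f_b(x) (so f_a = S^a f, the a-fold application of the scaling vector field S = x·∇). Then for every integer a with 1 ≤ a ≤ n one has ‖S^a f‖_{L^{2n/a}(ℝ³)} ≤ C · ‖f‖_{L^∞}^{1−a/n} · ( Σ_{b=0}^{n} ‖S^b f‖_{L²(ℝ³)} )^{a/n}. -/
open MeasureTheory ENNReal

/-- The scaling vector field `S` acting on functions: `Sf(x) = x·∇f(x)`. -/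
noncomputable def scalingVF (f : EuclideanSpace ℝ (Fin 3) → ℝ) :
    EuclideanSpace ℝ (Fin 3) → ℝ :=
  fun x => fderiv ℝ f x x

/-- The scaling vector field as an operator on Schwartz functions. -/
noncomputable def schwartzScaling :
    SchwartzMap (EuclideanSpace ℝ (Fin 3)) ℝ →L[ℝ] SchwartzMap (EuclideanSpace ℝ (Fin 3)) ℝ :=
  SchwartzMap.bilinLeftCLM (ContinuousLinearMap.id ℝ (EuclideanSpace ℝ (Fin 3) →L[ℝ] ℝ))
      Function.HasTemperateGrowth.id ∘L
    SchwartzMap.fderivCLM ℝ (EuclideanSpace ℝ (Fin 3)) ℝ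

lemma coe_schwartzScaling (f : SchwartzMap (EuclideanSpace ℝ (Fin 3)) ℝ) :
    ⇑(schwartzScaling f) = scalingVF f := by
  ext x
  simp [schwartzScaling, scalingVF, SchwartzMap.bilinLeftCLM_apply, SchwartzMap.fderivCLM_apply]

lemma coe_schwartzScaling_iterate (f : SchwartzMap (EuclideanSpace ℝ (Fin 3)) ℝ) (b : ℕ) :
    ⇑(schwartzScaling^[b] f) = scalingVF^[b] f := by
  induction b with
  | zero => rfl
  | succ b ih => rw [Function.iterate_succ_apply', Function.iterate_succ_apply',
      coe_schwartzScaling, ih]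

lemma SchwartzMap.integrable_mul_comp (w v : SchwartzMap (EuclideanSpace ℝ (Fin 3)) ℝ)
    {φ : ℝ → ℝ} (hφ : Continuous φ) : Integrable (fun x => w x * φ (v x)) := by
  obtain ⟨C, hC⟩ := (isCompact_closedBall (0 : ℝ)
    ‖v.toBoundedContinuousFunction‖).exists_bound_of_continuousOn hφ.continuousOn
  exact w.integrable.mul_bdd (c := C) (hφ.comp v.continuous).aestronglyMeasurable
    (.of_forall fun x => hC _ (mem_closedBall_zero_iff.2
      (v.toBoundedContinuousFunction.norm_coe_le_norm x)))

lemma fderiv_apply_eq_sum_single (L : EuclideanSpace ℝ (Fin 3) →L[ℝ] ℝ)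
    (x : EuclideanSpace ℝ (Fin 3)) :
    ∑ i, x i * L (EuclideanSpace.single i 1) = L x := by
  conv_rhs => rw [← (EuclideanSpace.basisFun (Fin 3) ℝ).sum_repr x]
  simp

lemma integral_coord_mul_fderiv_comp (u v : SchwartzMap (EuclideanSpace ℝ (Fin 3)) ℝ)
    {φ φ' : ℝ → ℝ} (hφ : ∀ t, HasDerivAt φ (φ' t) t) (hφ' : Continuous φ') (i : Fin 3) :
    Integrable (fun x => u x * φ' (v x) * (x i * fderiv ℝ v x (EuclideanSpace.single i 1))) ∧
    Integrable (fun x => (u x + x i * fderiv ℝ u x (EuclideanSpace.single i 1)) * φ (v x)) ∧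
    ∫ x, u x * φ' (v x) * (x i * fderiv ℝ v x (EuclideanSpace.single i 1)) =
      -∫ x, (u x + x i * fderiv ℝ u x (EuclideanSpace.single i 1)) * φ (v x) := by
  have hφc : Continuous φ := continuous_iff_continuousAt.2 fun t => (hφ t).continuousAt
  set e : EuclideanSpace ℝ (Fin 3) := EuclideanSpace.single i 1 with he
  have hproj : (fun x : EuclideanSpace ℝ (Fin 3) => x i).HasTemperateGrowth :=
    (EuclideanSpace.proj i : EuclideanSpace ℝ (Fin 3) →L[ℝ] ℝ).hasTemperateGrowth
  set mulCoord := SchwartzMap.smulLeftCLM (𝕜 := ℝ) ℝ (fun x : EuclideanSpace ℝ (Fin 3) => x i)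
  have hmul (w) (x) : mulCoord w x = x i * w x := by
    simp [mulCoord, SchwartzMap.smulLeftCLM_apply_apply hproj]
  set D := LineDeriv.lineDerivOp (E := SchwartzMap (EuclideanSpace ℝ (Fin 3)) ℝ) e
  have hD (w) (x) : D w x = fderiv ℝ w x e := by
    simp only [D, SchwartzMap.lineDerivOp_apply]
    exact w.differentiableAt.lineDeriv_eq_fderiv
  have hdmul (x) : fderiv ℝ (mulCoord u) x e = u x + x i * fderiv ℝ u x e := by
    have h1 : HasFDerivAt (fun x : EuclideanSpace ℝ (Fin 3) => x i)
        (EuclideanSpace.proj i : EuclideanSpace ℝ (Fin 3) →L[ℝ] ℝ) x :=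
      (EuclideanSpace.proj i : EuclideanSpace ℝ (Fin 3) →L[ℝ] ℝ).hasFDerivAt
    have h2 := h1.mul (u.differentiableAt (x := x)).hasFDerivAt
    rw [show ⇑(mulCoord u) = (fun x : EuclideanSpace ℝ (Fin 3) => x i) * ⇑u from funext (hmul u),
      h2.fderiv]
    simp [he]
    ring
  have hdcomp (x) : fderiv ℝ (fun x => φ (v x)) x e = φ' (v x) * fderiv ℝ v x e := by
    have := (hφ (v x)).comp_hasFDerivAt x (v.differentiableAt (x := x)).hasFDerivAt
    rw [show (fun x => φ (v x)) = φ ∘ v from rfl, this.fderiv]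
    simp
  have int1 : Integrable (fun x => u x * φ' (v x) * (x i * fderiv ℝ v x e)) := by
    obtain ⟨C, hC⟩ : ∃ C, ∀ x, ‖mulCoord (D v) x‖ ≤ C :=
      ⟨_, (mulCoord (D v)).toBoundedContinuousFunction.norm_coe_le_norm⟩
    refine ((u.integrable_mul_comp v hφ').mul_bdd (c := C)
      (mulCoord (D v)).continuous.aestronglyMeasurable (.of_forall hC)).congr
      (.of_forall fun x => ?_)
    simp only [hmul, hD]
  have int2 : Integrable (fun x => (u x + x i * fderiv ℝ u x e) * φ (v x)) := by
    refine ((u + mulCoord (D u)).integrable_mul_comp v hφc).congr (.of_forall fun x => ?_)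
    simp [hmul, hD]
  refine ⟨int1, int2, ?_⟩
  have key := integral_mul_fderiv_eq_neg_fderiv_mul_of_integrable (μ := volume)
    (f := mulCoord u) (g := fun x => φ (v x)) (v := e) (by simpa only [hdmul] using int2)
    (int1.congr (.of_forall fun x => by simp only [hmul, hdcomp]; ring))
    ((mulCoord u).integrable_mul_comp v hφc) (fun x _ => (mulCoord u).differentiableAt)
    (fun x _ => ((hφ (v x)).comp_hasFDerivAt x
      (v.differentiableAt (x := x)).hasFDerivAt).differentiableAt)
  simp only [hmul, hdcomp, hdmul] at key
  rw [← key]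
  exact integral_congr_ae (.of_forall fun x => by ring)

/-- Integration by parts for the scaling vector field, whose divergence is `3`. -/
lemma integral_scalingVF_mul_comp (u v : SchwartzMap (EuclideanSpace ℝ (Fin 3)) ℝ)
    {φ φ' : ℝ → ℝ} (hφ : ∀ t, HasDerivAt φ (φ' t) t) (hφ' : Continuous φ') :
    ∫ x, scalingVF u x * φ (v x) =
      -∫ x, u x * (3 * φ (v x) + φ' (v x) * scalingVF v x) := by
  have hφc : Continuous φ := continuous_iff_continuousAt.2 fun t => (hφ t).continuousAt
  choose int1 int2 key using integral_coord_mul_fderiv_comp u v hφ hφ'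
  have hsum := Finset.sum_congr rfl fun i (_ : i ∈ Finset.univ) => key i
  rw [Finset.sum_neg_distrib, ← integral_finsetSum _ fun i _ => int1 i,
    ← integral_finsetSum _ fun i _ => int2 i] at hsum
  have e1 (x) : ∑ i, u x * φ' (v x) * (x i * fderiv ℝ v x (EuclideanSpace.single i 1)) =
      u x * φ' (v x) * scalingVF v x := by
    rw [← Finset.mul_sum, fderiv_apply_eq_sum_single, scalingVF]
  have e2 (x) : ∑ i, (u x + x i * fderiv ℝ u x (EuclideanSpace.single i 1)) * φ (v x) =
      3 * (u x * φ (v x)) + scalingVF u x * φ (v x) := by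
    rw [← Finset.sum_mul, Finset.sum_add_distrib, fderiv_apply_eq_sum_single, scalingVF]
    simp
    ring
  have i1 := (integrable_finsetSum Finset.univ fun i _ => int1 i)
  have i3 := (u.integrable_mul_comp v hφc).const_mul 3
  have i4 : Integrable fun x => scalingVF u x * φ (v x) := by
    simpa only [coe_schwartzScaling] using (schwartzScaling u).integrable_mul_comp v hφc
  simp only [e1, e2] at hsum i1
  rw [integral_add i3 i4] at hsum
  have : ∫ x, u x * (3 * φ (v x) + φ' (v x) * scalingVF v x) =
      (∫ x, 3 * (u x * φ (v x))) + ∫ x, u x * φ' (v x) * scalingVF v x := by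
    rw [← integral_add i3 i1]
    exact integral_congr_ae (.of_forall fun x => by ring)
  linarith

lemma hasDerivAt_abs_rpow_mul_self {q : ℝ} (hq : 0 < q) (t : ℝ) :
    HasDerivAt (fun t : ℝ => |t| ^ q * t) ((q + 1) * |t| ^ q) t := by
  have hc : Continuous fun t : ℝ => |t| ^ q := continuous_abs.rpow_const fun _ => .inr hq.le
  refine hasDerivAt_of_hasDerivAt_of_ne' (x := 0) (g := fun t => (q + 1) * |t| ^ q)
    (fun y hy => ?_) (hc.mul continuous_id).continuousAt (hc.const_mul _).continuousAt t
  have hy' : |y| ≠ 0 := abs_ne_zero.2 hy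
  refine (((hasDerivAt_abs hy).rpow_const (p := q) (.inl hy')).mul
    (hasDerivAt_id' y)).congr_deriv ?_
  have : (SignType.sign y : ℝ) * y = |y| := sign_mul_self y
  rw [show (SignType.sign y : ℝ) * q * |y| ^ (q - 1) * y =
    q * |y| ^ (q - 1) * (SignType.sign y * y) by ring, this, Real.rpow_sub_one hy']
  field_simp

lemma lintegral_mul_rpow_mul_le {α : Type*} [MeasurableSpace α] {μ : Measure α} {u v w : α → ℝ}
    (hu : AEStronglyMeasurable u μ) (hv : AEStronglyMeasurable v μ)
    (hw : AEStronglyMeasurable w μ) {p : ℝ} (hp : 2 < p) {p₁ p₂ : ℝ≥0∞}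
    (hpp : p₁⁻¹ + p₂⁻¹ = 2 / ENNReal.ofReal p) :
    ∫⁻ x, ‖u x‖ₑ * ‖v x‖ₑ ^ (p - 2) * ‖w x‖ₑ ∂μ ≤
      eLpNorm u p₁ μ * eLpNorm w p₂ μ * eLpNorm v (ENNReal.ofReal p) μ ^ (p - 2) := by
  have hp0 : 0 < p := by linarith
  have hq : 0 < p - 2 := by linarith
  have h2 : (2 : ℝ≥0∞) = ENNReal.ofReal 2 := by simp
  have : ENNReal.HolderTriple p₁ p₂ (ENNReal.ofReal (p / 2)) := ⟨by
    rw [hpp, h2, ← ENNReal.ofReal_div_of_pos hp0, ← ENNReal.ofReal_inv_of_pos (by positivity),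
      inv_div]⟩
  have : ENNReal.HolderTriple (ENNReal.ofReal (p / 2)) (ENNReal.ofReal (p / (p - 2))) 1 := ⟨by
    rw [← ENNReal.ofReal_inv_of_pos (by positivity), ← ENNReal.ofReal_inv_of_pos (by positivity),
      ← ENNReal.ofReal_add (by positivity) (by positivity), inv_div, inv_div, ← add_div,
      add_sub_cancel, div_self hp0.ne', ENNReal.ofReal_one, inv_one]⟩
  have hvq : AEStronglyMeasurable (fun x => ‖v x‖ ^ (p - 2)) μ :=
    (Real.continuous_rpow_const hq.le).comp_aestronglyMeasurable hv.norm
  calc ∫⁻ x, ‖u x‖ₑ * ‖v x‖ₑ ^ (p - 2) * ‖w x‖ₑ ∂μ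
      = eLpNorm ((u • w) • fun x => ‖v x‖ ^ (p - 2)) 1 μ := by
        rw [eLpNorm_one_eq_lintegral_enorm]
        refine lintegral_congr fun x => ?_
        simp only [Pi.smul_apply', smul_eq_mul, Pi.mul_apply, enorm_mul,
          Real.enorm_rpow_of_nonneg (norm_nonneg _) hq.le,
          enorm_norm]
        ring
    _ ≤ eLpNorm (u • w) (ENNReal.ofReal (p / 2)) μ *
          eLpNorm (fun x => ‖v x‖ ^ (p - 2)) (ENNReal.ofReal (p / (p - 2))) μ :=
        eLpNorm_smul_le_mul_eLpNorm hvq (hu.smul hw)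
    _ ≤ _ := by
        rw [eLpNorm_norm_rpow _ hq, ← ENNReal.ofReal_mul (by positivity), div_mul_cancel₀ _ hq.ne']
        gcongr
        exact eLpNorm_smul_le_mul_eLpNorm hw hu

lemma eLpNorm_rpow_eq_lintegral {α : Type*} [MeasurableSpace α] {μ : Measure α} (v : α → ℝ) {p : ℝ}
    (hp : 0 < p) : eLpNorm v (ENNReal.ofReal p) μ ^ p = ∫⁻ x, ‖v x‖ₑ ^ p ∂μ := by
  rw [eLpNorm_eq_lintegral_rpow_enorm_toReal (by simpa using hp) ENNReal.ofReal_ne_top,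
    ENNReal.toReal_ofReal hp.le, ← ENNReal.rpow_mul, one_div_mul_cancel hp.ne', ENNReal.rpow_one]

lemma ENNReal.sq_le_of_rpow_le_mul_rpow {A X : ℝ≥0∞} {p : ℝ} (hp : 2 < p) (hA : A ≠ ⊤)
    (h : A ^ p ≤ X * A ^ (p - 2)) : A ^ 2 ≤ X := by
  rcases eq_or_ne A 0 with rfl | hA0
  · simp
  · have hne : A ^ (p - 2) ≠ 0 := (ENNReal.rpow_pos (pos_iff_ne_zero.2 hA0) hA).ne'
    have hnt : A ^ (p - 2) ≠ ⊤ := ENNReal.rpow_ne_top_of_nonneg (by linarith) hA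
    rw [← ENNReal.mul_le_mul_iff_left hne hnt]
    convert h using 1
    rw [← ENNReal.rpow_two, ← ENNReal.rpow_add _ _ hA0 hA]
    ring_nf

lemma eLpNorm_sq_le_mul_eLpNorm (u : SchwartzMap (EuclideanSpace ℝ (Fin 3)) ℝ) {p : ℝ} (hp : 2 < p)
    {p₁ p₂ : ℝ≥0∞} (hpp : p₁⁻¹ + p₂⁻¹ = 2 / ENNReal.ofReal p) :
    eLpNorm u (ENNReal.ofReal p) volume ^ 2 ≤ eLpNorm u p₁ volume * eLpNorm u p₂ volume := by
  have hu := u.continuous.aestronglyMeasurable (μ := volume)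
  refine ENNReal.sq_le_of_rpow_le_mul_rpow hp (u.memLp (ENNReal.ofReal p) volume).eLpNorm_ne_top ?_
  rw [eLpNorm_rpow_eq_lintegral _ (by linarith)]
  have hpow (x) : ‖u x‖ₑ * ‖u x‖ₑ ^ (p - 2) * ‖u x‖ₑ = ‖u x‖ₑ ^ p := by
    rw [mul_right_comm, ← sq, ← ENNReal.rpow_two,
      ← ENNReal.rpow_add_of_nonneg _ _ (by norm_num) (by linarith), add_sub_cancel]
  have key := lintegral_mul_rpow_mul_le hu hu hu hp hpp
  simpa only [hpow] using key

lemma eLpNorm_scalingVF_sq_le (u : SchwartzMap (EuclideanSpace ℝ (Fin 3)) ℝ) {p : ℝ} (hp : 2 < p)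
    {p₁ p₂ : ℝ≥0∞} (hpp : p₁⁻¹ + p₂⁻¹ = 2 / ENNReal.ofReal p) :
    eLpNorm (scalingVF u) (ENNReal.ofReal p) volume ^ 2 ≤
      eLpNorm u p₁ volume * (3 * eLpNorm (scalingVF u) p₂ volume +
        ENNReal.ofReal (p - 1) * eLpNorm (scalingVF (scalingVF u)) p₂ volume) := by
  have hq : 0 < p - 2 := by linarith
  rw [← coe_schwartzScaling, ← coe_schwartzScaling]
  set v := schwartzScaling u with hv_def
  have hu := u.continuous.aestronglyMeasurable (μ := volume)
  have hv := v.continuous.aestronglyMeasurable (μ := volume)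
  have hw := (schwartzScaling v).continuous.aestronglyMeasurable (μ := volume)
  have hmeas (w : SchwartzMap (EuclideanSpace ℝ (Fin 3)) ℝ) :
      Measurable fun x => ‖u x‖ₑ * ‖v x‖ₑ ^ (p - 2) * ‖w x‖ₑ :=
    (u.continuous.measurable.enorm.mul (v.continuous.measurable.enorm.pow_const _)).mul
      w.continuous.measurable.enorm
  have hc : Continuous fun t : ℝ => |t| ^ (p - 2) :=
    continuous_abs.rpow_const fun _ => .inr hq.le
  have parts := integral_scalingVF_mul_comp u v (hasDerivAt_abs_rpow_mul_self hq)
    (hc.const_mul (p - 2 + 1))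
  rw [← coe_schwartzScaling, ← coe_schwartzScaling, ← hv_def] at parts
  have hnn (x) : 0 ≤ v x * (|v x| ^ (p - 2) * v x) := by
    rw [mul_left_comm]; exact mul_nonneg (by positivity) (mul_self_nonneg _)
  refine ENNReal.sq_le_of_rpow_le_mul_rpow hp (v.memLp (ENNReal.ofReal p) volume).eLpNorm_ne_top ?_
  calc eLpNorm v (ENNReal.ofReal p) volume ^ p
      = ∫⁻ x, ENNReal.ofReal (v x * (|v x| ^ (p - 2) * v x)) := by
        rw [eLpNorm_rpow_eq_lintegral _ (by linarith)]
        refine lintegral_congr fun x => ?_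
        rw [← Real.enorm_of_nonneg (hnn x), enorm_mul, enorm_mul, ← Real.norm_eq_abs,
          Real.enorm_rpow_of_nonneg (norm_nonneg _) hq.le, enorm_norm, mul_left_comm, ← sq,
          ← ENNReal.rpow_two, ← ENNReal.rpow_add_of_nonneg _ _ hq.le (by norm_num),
          sub_add_cancel]
    _ = ‖∫ x, v x * (|v x| ^ (p - 2) * v x)‖ₑ := by
        rw [Real.enorm_of_nonneg (integral_nonneg hnn),
          ofReal_integral_eq_lintegral_ofReal _ (.of_forall hnn)]
        exact v.integrable_mul_comp v (hc.mul continuous_id)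
    _ ≤ ∫⁻ x, ‖u x * (3 * (|v x| ^ (p - 2) * v x) +
          (p - 2 + 1) * |v x| ^ (p - 2) * schwartzScaling v x)‖ₑ := by
        rw [parts, enorm_neg]
        exact enorm_integral_le_lintegral_enorm _
    _ ≤ ∫⁻ x, (3 * (‖u x‖ₑ * ‖v x‖ₑ ^ (p - 2) * ‖v x‖ₑ) +
          ENNReal.ofReal (p - 1) * (‖u x‖ₑ * ‖v x‖ₑ ^ (p - 2) * ‖schwartzScaling v x‖ₑ)) := by
        refine lintegral_mono fun x => ?_
        rw [enorm_mul]
        refine (mul_le_mul_right (enorm_add_le _ _) _).trans (le_of_eq ?_)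
        rw [← Real.norm_eq_abs]
        simp only [enorm_mul, Real.enorm_rpow_of_nonneg (norm_nonneg (v x)) hq.le, enorm_norm,
          Real.enorm_of_nonneg (show (0 : ℝ) ≤ 3 by norm_num),
          Real.enorm_of_nonneg (show 0 ≤ p - 1 by linarith), ENNReal.ofReal_ofNat,
          show p - 2 + 1 = p - 1 by ring]
        ring
    _ = 3 * (∫⁻ x, ‖u x‖ₑ * ‖v x‖ₑ ^ (p - 2) * ‖v x‖ₑ) + ENNReal.ofReal (p - 1) *
          ∫⁻ x, ‖u x‖ₑ * ‖v x‖ₑ ^ (p - 2) * ‖schwartzScaling v x‖ₑ := by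
        rw [lintegral_add_left ((hmeas v).const_mul _), lintegral_const_mul _ (hmeas _),
          lintegral_const_mul _ (hmeas _)]
    _ ≤ 3 * (eLpNorm u p₁ volume * eLpNorm v p₂ volume *
          eLpNorm v (ENNReal.ofReal p) volume ^ (p - 2)) + ENNReal.ofReal (p - 1) *
          (eLpNorm u p₁ volume * eLpNorm (schwartzScaling v) p₂ volume *
          eLpNorm v (ENNReal.ofReal p) volume ^ (p - 2)) := by
        gcongr <;> exact lintegral_mul_rpow_mul_le hu hv ‹_› hp hpp
    _ = _ := by ring

lemma log_convex_interpolation {n : ℕ} (hn : 1 ≤ n) {K : ℝ} (hK : 1 ≤ K) {B : ℕ → ℝ}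
    (hB : ∀ k, 0 < B k) (h : ∀ k, k + 2 ≤ n → B (k + 1) ^ 2 ≤ K * (B k * B (k + 2)))
    {a : ℕ} (ha : a ≤ n) :
    B a ≤ K ^ (n ^ 2) * B 0 ^ (1 - (a : ℝ) / n) * B n ^ ((a : ℝ) / n) := by
  have hK0 : 0 < K := by linarith
  have hL : 0 ≤ Real.log K := Real.log_nonneg hK
  have hn0 : (0 : ℝ) < n := by exact_mod_cast hn
  set H : ℕ → ℝ := fun k => Real.log (B k) - Real.log (B 0) + Real.log K * (k : ℝ) ^ 2 / 2
  have hH0 : H 0 = 0 := by simp [H]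
  have hconv (k) (hk : k + 2 ≤ n) : 2 * H (k + 1) ≤ H k + H (k + 2) := by
    have := Real.log_le_log (pow_pos (hB _) 2) (h k hk)
    rw [Real.log_pow, Real.log_mul hK0.ne' (mul_pos (hB _) (hB _)).ne',
      Real.log_mul (hB _).ne' (hB _).ne'] at this
    simp only [H]
    push_cast at this ⊢
    linarith
  have hslope (k : ℕ) (hk : k + 1 ≤ n) : ((k : ℝ) + 1) * H k ≤ k * H (k + 1) := by
    induction k with
    | zero => simp [hH0]
    | succ k ih =>
      have h1 := ih (by omega)
      have h2 := mul_le_mul_of_nonneg_left (hconv k (by omega)) (by positivity : (0 : ℝ) ≤ k + 1)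
      push_cast
      linarith
  have hmono (m : ℕ) (ham : a ≤ m) (hmn : m ≤ n) : (m : ℝ) * H a ≤ a * H m := by
    induction m, ham using Nat.le_induction with
    | base => rfl
    | succ m ham ih =>
      rcases Nat.eq_zero_or_pos m with rfl | hm
      · obtain rfl : a = 0 := by omega
        simp [hH0]
      · have h1 := ih (by omega)
        have h2 := hslope m (by omega)
        have hm' : (0 : ℝ) < m := by exact_mod_cast hm
        refine le_of_mul_le_mul_left ?_ hm'
        have h3 := mul_le_mul_of_nonneg_left h1 (by positivity : (0 : ℝ) ≤ m + 1)
        have h4 := mul_le_mul_of_nonneg_left h2 (by positivity : (0 : ℝ) ≤ a)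
        push_cast
        linarith
  have hfin := hmono n ha le_rfl
  have ht : (a : ℝ) / n ≤ 1 := (div_le_one hn0).2 (by exact_mod_cast ha)
  have hdiv : H a ≤ (a : ℝ) / n * H n := by
    rw [div_mul_eq_mul_div, le_div_iff₀ hn0]; linarith
  rw [← Real.log_le_log_iff (hB a) (by have := hB 0; have := hB n; positivity),
    Real.log_mul (by have := hB 0; positivity) (Real.rpow_pos_of_pos (hB n) _).ne',
    Real.log_mul (by positivity) (Real.rpow_pos_of_pos (hB 0) _).ne', Real.log_pow,
    Real.log_rpow (hB 0), Real.log_rpow (hB n)]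
  simp only [H] at hdiv
  have h5 : (a : ℝ) / n * (Real.log K * (n : ℝ) ^ 2 / 2) ≤ Real.log K * (n : ℝ) ^ 2 / 2 :=
    mul_le_of_le_one_left (by positivity) ht
  have h6 : 0 ≤ Real.log K * (a : ℝ) ^ 2 / 2 := by positivity
  have h7 : 0 ≤ Real.log K * (n : ℝ) ^ 2 := by positivity
  push_cast
  linarith

/-- The largest of the norms of `f, Sf, …, S^k f` in `L^{2n/k}`, which is `L^∞` for `k = 0`. -/
noncomputable def scalingNormSup (n : ℕ) (f : SchwartzMap (EuclideanSpace ℝ (Fin 3)) ℝ) (k : ℕ) :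
    ℝ≥0∞ :=
  (Finset.range (k + 1)).sup fun b => eLpNorm (scalingVF^[b] f) (2 * n / k) volume

lemma eLpNorm_le_scalingNormSup (n : ℕ) (f : SchwartzMap (EuclideanSpace ℝ (Fin 3)) ℝ) {b k : ℕ}
    (hb : b ≤ k) : eLpNorm (scalingVF^[b] f) (2 * n / k) volume ≤ scalingNormSup n f k :=
  Finset.le_sup (f := fun b => eLpNorm (scalingVF^[b] f) (2 * n / k) volume)
    (Finset.mem_range.2 (by omega))

lemma scalingNormSup_ne_top (n : ℕ) (f : SchwartzMap (EuclideanSpace ℝ (Fin 3)) ℝ) (k : ℕ) :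
    scalingNormSup n f k ≠ ⊤ := by
  rw [scalingNormSup, ← lt_top_iff_ne_top, Finset.sup_lt_iff (by simp)]
  intro b _
  rw [← coe_schwartzScaling_iterate]
  exact ((schwartzScaling^[b] f).memLp _ volume).eLpNorm_lt_top

lemma scalingNormSup_ne_zero {n : ℕ} (hn : 1 ≤ n)
    {f : SchwartzMap (EuclideanSpace ℝ (Fin 3)) ℝ} (hf : f ≠ 0) (k : ℕ) :
    scalingNormSup n f k ≠ 0 := by
  intro h
  have h0 : eLpNorm f (2 * n / k) volume = 0 :=

    nonpos_iff_eq_zero.1 ((eLpNorm_le_scalingNormSup n f (Nat.zero_le k)).trans h.le)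
  have hp : (2 * n / k : ℝ≥0∞) ≠ 0 := by
    simp only [ne_eq, ENNReal.div_eq_zero_iff, mul_eq_zero, Nat.cast_eq_zero]
    rintro ((h | h) | h)
    · norm_num at h
    · omega
    · exact ENNReal.natCast_ne_top k h
  rw [eLpNorm_eq_zero_iff f.continuous.aestronglyMeasurable hp] at h0
  have h1 : ⇑f = 0 := (f.continuous.ae_eq_iff_eq volume continuous_const).1 h0
  exact hf (DFunLike.coe_injective h1)

lemma scalingNormSup_zero {n : ℕ} (hn : 1 ≤ n)
    (f : SchwartzMap (EuclideanSpace ℝ (Fin 3)) ℝ) :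
    scalingNormSup n f 0 = eLpNorm f ⊤ volume := by
  have : (2 * n / (0 : ℕ) : ℝ≥0∞) = ⊤ := by
    rw [Nat.cast_zero, ENNReal.div_zero]
    simp
    omega
  rw [scalingNormSup, this]
  simp

lemma scalingNormSup_self_le {n : ℕ} (hn : 1 ≤ n)
    (f : SchwartzMap (EuclideanSpace ℝ (Fin 3)) ℝ) :
    scalingNormSup n f n ≤ ∑ b ∈ Finset.range (n + 1), eLpNorm (scalingVF^[b] f) 2 volume := by
  have : (2 * n / n : ℝ≥0∞) = 2 :=
    ENNReal.mul_div_cancel_right (by simp; omega) (ENNReal.natCast_ne_top n)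
  refine Finset.sup_le fun b hb => ?_
  rw [this]
  exact Finset.single_le_sum (f := fun b => eLpNorm (scalingVF^[b] f) 2 volume)
    (fun _ _ => zero_le) hb

lemma two_mul_div_eq_ofReal (n : ℕ) {k : ℕ} (hk : 1 ≤ k) :
    (2 * n / k : ℝ≥0∞) = ENNReal.ofReal (2 * n / k) := by
  rw [ENNReal.ofReal_div_of_pos (by exact_mod_cast hk), ENNReal.ofReal_mul (by norm_num)]
  simp

lemma inv_two_mul_div_add_inv (n k : ℕ) (hn : 1 ≤ n) :
    (2 * n / k : ℝ≥0∞)⁻¹ + (2 * n / (k + 2 : ℕ) : ℝ≥0∞)⁻¹ = 2 / (2 * n / (k + 1 : ℕ)) := by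
  have h0 : (2 * n : ℝ≥0∞) ≠ 0 := by simp; omega
  have ht : (2 * n : ℝ≥0∞) ≠ ⊤ := ENNReal.mul_ne_top (by simp) (ENNReal.natCast_ne_top n)
  rw [ENNReal.inv_div (.inr ht) (.inr h0), ENNReal.inv_div (.inr ht) (.inr h0),
    div_eq_mul_inv 2, ENNReal.inv_div (.inr ht) (.inr h0), ENNReal.div_add_div_same,
    ← mul_div_assoc]
  congr 1
  push_cast
  ring

lemma scalingNormSup_sq_le (n : ℕ) (f : SchwartzMap (EuclideanSpace ℝ (Fin 3)) ℝ) (k : ℕ)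
    (hk : k + 2 ≤ n) : scalingNormSup n f (k + 1) ^ 2 ≤
      ENNReal.ofReal (3 + 2 * n) * (scalingNormSup n f k * scalingNormSup n f (k + 2)) := by
  have hk0 : (0 : ℝ) < (k + 1 : ℕ) := by positivity
  have hp : 2 < (2 * n / (k + 1 : ℕ) : ℝ) := by
    rw [lt_div_iff₀ hk0]
    exact_mod_cast (by omega : 2 * (k + 1) < 2 * n)
  have hp1 : (2 * n / (k + 1 : ℕ) : ℝ) - 1 ≤ 2 * n := by
    have := div_le_self (by positivity : (0 : ℝ) ≤ 2 * n)
      (by simp : (1 : ℝ) ≤ (k + 1 : ℕ))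
    linarith
  have hpp := inv_two_mul_div_add_inv n k (by omega)
  rw [two_mul_div_eq_ofReal n (by omega : 1 ≤ k + 1)] at hpp
  obtain ⟨b, hb, hsup⟩ := Finset.exists_mem_eq_sup (Finset.range (k + 1 + 1)) (by simp)
    fun b => eLpNorm (scalingVF^[b] f) (2 * n / (k + 1 : ℕ)) volume
  rw [Finset.mem_range] at hb
  rw [scalingNormSup, hsup, two_mul_div_eq_ofReal n (by omega : 1 ≤ k + 1)]
  cases b with
  | zero =>
    refine (eLpNorm_sq_le_mul_eLpNorm f hp hpp).trans ?_
    refine (mul_le_mul' (eLpNorm_le_scalingNormSup n f (Nat.zero_le k))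
      (eLpNorm_le_scalingNormSup n f (Nat.zero_le (k + 2)))).trans (le_mul_of_one_le_left' ?_)
    rw [ENNReal.one_le_ofReal]
    linarith [Nat.cast_nonneg (α := ℝ) n]
  | succ c =>
    have h := eLpNorm_scalingVF_sq_le (schwartzScaling^[c] f) hp hpp
    simp only [coe_schwartzScaling_iterate, ← Function.iterate_succ_apply'] at h
    refine h.trans ?_
    calc _ ≤ scalingNormSup n f k * (3 * scalingNormSup n f (k + 2) +
          ENNReal.ofReal (2 * n) * scalingNormSup n f (k + 2)) := by
          gcongr
          · exact eLpNorm_le_scalingNormSup n f (by omega)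
          · exact eLpNorm_le_scalingNormSup n f (by omega)
          · exact eLpNorm_le_scalingNormSup n f (by omega)
      _ = _ := by
          rw [ENNReal.ofReal_add (by norm_num) (by positivity), ENNReal.ofReal_ofNat]
          ring

/-- **Interpolation lemma for the scaling vector field (equation (5.4)).**
For every `n ≥ 1` there is `C > 0` such that for Schwartz `f` and `1 ≤ a ≤ n`,
`‖S^a f‖_{L^{2n/a}} ≤ C ‖f‖_{L^∞}^{1−a/n} (∑_{b=0}^n ‖S^b f‖_{L²})^{a/n}`. -/
theorem stmt_3 (n : ℕ) (hn : 1 ≤ n) :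
    ∃ C : ℝ, 0 < C ∧
      ∀ (f : SchwartzMap (EuclideanSpace ℝ (Fin 3)) ℝ) (a : ℕ), 1 ≤ a → a ≤ n →
        eLpNorm (scalingVF^[a] ⇑f) (ENNReal.ofReal ((2 * n : ℝ) / (a : ℝ))) volume
          ≤ ENNReal.ofReal C
            * eLpNorm (⇑f) ⊤ volume ^ ((1 : ℝ) - (a : ℝ) / (n : ℝ))
            * (∑ b ∈ Finset.range (n + 1), eLpNorm (scalingVF^[b] ⇑f) 2 volume)
              ^ ((a : ℝ) / (n : ℝ)) := by
  refine ⟨(3 + 2 * n) ^ (n ^ 2), by positivity, fun f a ha han => ?_⟩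
  rcases eq_or_ne f 0 with rfl | hf
  · have hz : schwartzScaling^[a] 0 = 0 := Function.iterate_fixed (map_zero _) a
    rw [← coe_schwartzScaling_iterate, hz]
    simp
  have hpos (k) : 0 < (scalingNormSup n f k).toReal :=
    ENNReal.toReal_pos (scalingNormSup_ne_zero hn hf k) (scalingNormSup_ne_top n f k)
  have key := log_convex_interpolation hn (K := 3 + 2 * n)
    (by linarith [Nat.cast_nonneg (α := ℝ) n]) hpos (fun k hk => by
      have h := ENNReal.toReal_mono (ENNReal.mul_ne_top ENNReal.ofReal_ne_top
        (ENNReal.mul_ne_top (scalingNormSup_ne_top n f k) (scalingNormSup_ne_top n f (k + 2))))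
         (scalingNormSup_sq_le n f k hk)
      rwa [ENNReal.toReal_pow, ENNReal.toReal_mul, ENNReal.toReal_mul,
        ENNReal.toReal_ofReal (by positivity)] at h) han
  have key' := ENNReal.ofReal_le_ofReal key
  rw [ENNReal.ofReal_mul (by positivity), ENNReal.ofReal_mul (by positivity),
    ← ENNReal.ofReal_rpow_of_pos (hpos 0), ← ENNReal.ofReal_rpow_of_pos (hpos n),
    ENNReal.ofReal_toReal (scalingNormSup_ne_top n f a),
    ENNReal.ofReal_toReal (scalingNormSup_ne_top n f 0),
    ENNReal.ofReal_toReal (scalingNormSup_ne_top n f n), scalingNormSup_zero hn] at key'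
  rw [← two_mul_div_eq_ofReal n ha]
  refine (eLpNorm_le_scalingNormSup n f le_rfl).trans (key'.trans ?_)
  gcongr
  exact scalingNormSup_self_le hn f
end
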